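/- arXiv:1802.09056 — 2 statements merged into one kernel-verified Lean document; each statement's English description precedes it below -/
import Mathlib

section
/- If F = [F_{ij}] : 𝔻 → ℂ^{2×2} is analytic with ‖F(λ)‖ ≤ 1 for all λ ∈ 𝔻, then the map λ ↦ (F₁₁(λ), F₂₂(λ), det F(λ)) is an analytic map of 𝔻 into ℂ³ whose range is contained in Ē. -/
/-- The closed tetrablock. -/
def closedTetra : Set (ℂ × ℂ × ℂ) :=
  {x | ∀ z ∈ Metric.ball (0:ℂ) 1, ∀ w ∈ Metric.ball (0:ℂ) 1,
        1 - x.1 * z - x.2.1 * w + x.2.2 * z * w ≠ 0}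

/-- The operator norm of a 2×2 complex matrix with respect to the Euclidean norm on ℂ². -/
noncomputable def opNorm2 (A : Matrix (Fin 2) (Fin 2) ℂ) : ℝ :=
  ‖Matrix.toEuclideanCLM (𝕜 := ℂ) A‖

/-- A contraction satisfies `‖A v‖² ≤ ‖v‖²` in coordinates. -/
theorem norm_sq_mulVec_le_of_opNorm2_le_one {A : Matrix (Fin 2) (Fin 2) ℂ} (hA : opNorm2 A ≤ 1)
    (v : Fin 2 → ℂ) :
    ‖A.mulVec v 0‖ ^ 2 + ‖A.mulVec v 1‖ ^ 2 ≤ ‖v 0‖ ^ 2 + ‖v 1‖ ^ 2 := by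
  have h : ‖Matrix.toEuclideanCLM (𝕜 := ℂ) A (WithLp.toLp 2 v)‖ ≤ 1 * ‖WithLp.toLp 2 v‖ :=
    ContinuousLinearMap.le_of_opNorm_le _ hA _
  rw [one_mul, Matrix.toEuclideanCLM_toLp] at h
  simpa [EuclideanSpace.norm_sq_eq, Fin.sum_univ_two] using
    pow_le_pow_left₀ (norm_nonneg _) h 2

/-- The tetrablock polynomial of `(A₁₁, A₂₂, det A)` is `det (1 - A * diag(z, w))`, which does not
vanish on the open bidisc when `A` is a contraction. -/
theorem mem_closedTetra_of_opNorm2_le_one {A : Matrix (Fin 2) (Fin 2) ℂ} (hA : opNorm2 A ≤ 1) :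
    (A 0 0, A 1 1, A.det) ∈ closedTetra := by
  intro z hz w hw h
  rw [mem_ball_zero_iff] at hz hw
  have hdet : (1 - A * Matrix.diagonal ![z, w]).det = 0 := by
    rw [← h]
    simp [Matrix.det_fin_two, Matrix.mul_diagonal]
    ring
  obtain ⟨v, hv, hAv⟩ := Matrix.exists_mulVec_eq_zero_iff.mpr hdet
  rw [Matrix.sub_mulVec, Matrix.one_mulVec, sub_eq_zero, ← Matrix.mulVec_mulVec] at hAv
  have hle := norm_sq_mulVec_le_of_opNorm2_le_one hA ((Matrix.diagonal ![z, w]).mulVec v)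
  rw [← hAv] at hle
  simp only [Matrix.mulVec_diagonal, Matrix.cons_val_zero, Matrix.cons_val_one, norm_mul,
    mul_pow] at hle
  have hz2 : ‖z‖ ^ 2 < 1 := pow_lt_one₀ (norm_nonneg z) hz two_ne_zero
  have hw2 : ‖w‖ ^ 2 < 1 := pow_lt_one₀ (norm_nonneg w) hw two_ne_zero
  have h0 : ‖v 0‖ ^ 2 = 0 := by nlinarith [sq_nonneg ‖v 0‖, sq_nonneg ‖v 1‖]
  have h1 : ‖v 1‖ ^ 2 = 0 := by nlinarith [sq_nonneg ‖v 0‖, sq_nonneg ‖v 1‖]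
  refine hv (funext fun i => ?_)
  fin_cases i
  · simpa using h0
  · simpa using h1

theorem stmt_12 (F : ℂ → Matrix (Fin 2) (Fin 2) ℂ)
    (hF : ∀ i j, DifferentiableOn ℂ (fun z => F z i j) (Metric.ball (0:ℂ) 1))
    (hFnorm : ∀ z ∈ Metric.ball (0:ℂ) 1, opNorm2 (F z) ≤ 1) :
    DifferentiableOn ℂ (fun z => ((F z 0 0, F z 1 1, (F z).det) : ℂ × ℂ × ℂ))
        (Metric.ball (0:ℂ) 1) ∧
      ∀ z ∈ Metric.ball (0:ℂ) 1, (F z 0 0, F z 1 1, (F z).det) ∈ closedTetra := by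
  refine ⟨?_, fun z hz => mem_closedTetra_of_opNorm2_le_one (hFnorm z hz)⟩
  simp only [Matrix.det_fin_two]
  exact (hF 0 0).prodMk ((hF 1 1).prodMk
    (((hF 0 0).mul (hF 1 1)).sub ((hF 0 1).mul (hF 1 0))))
end

section
/- Let x = (x₁,x₂,x₃) : 𝔻 → ℂ³ be an analytic map with x(𝔻) ⊆ Ē. Then there exists an analytic function F = [F_{ij}] : 𝔻 → ℂ^{2×2} with ‖F(λ)‖ ≤ 1 for all λ ∈ 𝔻 such that x₁ = F₁₁, x₂ = F₂₂, x₃ = det F on 𝔻, and such that for all μ, λ ∈ 𝔻 and all w, z ∈ ℂ with 1 − F₂₂(μ)w ≠ 0 and 1 − F₂₂(λ)z ≠ 0 one has 1 − conj(Ψ(w, x(μ)))·Ψ(z, x(λ)) = (1 − conj(w)z)·conj(γ(μ,w))·γ(λ,z) + η(μ,w)* (I − F(μ)* F(λ)) η(λ,z), where γ(λ,z) = (1 − F₂₂(λ)z)⁻¹ F₂₁(λ) and η(λ,z) is the column vector (1, zγ(λ,z)) in ℂ². -/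
open scoped Matrix

/-- The rational function Ψ(z, x₁, x₂, x₃) = (x₃ z − x₁)/(x₂ z − 1). -/
noncomputable def Psi (z x₁ x₂ x₃ : ℂ) : ℂ := (x₃ * z - x₁) / (x₂ * z - 1)

open Metric Filter Topology ComplexConjugate

lemma closedTetra_swap {x₁ x₂ x₃ : ℂ} (h : (x₁, x₂, x₃) ∈ closedTetra) :
    (x₂, x₁, x₃) ∈ closedTetra := by
  intro z hz w hw h0
  refine h w hw z hz ?_
  simp only at h0 ⊢
  linear_combination h0

lemma norm_sub_mul_le_of_mem_closedTetra {x₁ x₂ x₃ : ℂ} (h : (x₁, x₂, x₃) ∈ closedTetra)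
    {w : ℂ} (hw : w ∈ closedBall (0 : ℂ) 1) : ‖x₁ - x₃ * w‖ ≤ ‖1 - x₂ * w‖ := by
  have hcl : closedBall (0 : ℂ) 1 ⊆ {w | ‖x₁ - x₃ * w‖ ≤ ‖1 - x₂ * w‖} := by
    rw [← closure_ball (0 : ℂ) one_ne_zero]
    refine closure_minimal (fun w hw ↦ ?_)
      (isClosed_le (by fun_prop) (by fun_prop))
    by_contra! hlt
    simp only [Set.mem_ofPred_eq, not_le] at hlt
    have hne : x₁ - x₃ * w ≠ 0 := norm_pos_iff.1 ((norm_nonneg _).trans_lt hlt)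
    refine h ((1 - x₂ * w) / (x₁ - x₃ * w)) ?_ w hw ?_
    · rw [mem_ball_zero_iff, norm_div, div_lt_one (norm_pos_iff.2 hne)]
      exact hlt
    · have := div_mul_cancel₀ (1 - x₂ * w) hne
      linear_combination -this
  exact hcl hw

lemma two_mul_norm_le_of_mem_closedTetra {x₁ x₂ x₃ : ℂ} (h : (x₁, x₂, x₃) ∈ closedTetra) :
    2 * ‖x₂ - conj x₁ * x₃‖ ≤ 1 + ‖x₂‖ ^ 2 - ‖x₁‖ ^ 2 - ‖x₃‖ ^ 2 := by
  obtain ⟨w, hw, hwe⟩ : ∃ w : ℂ, ‖w‖ = 1 ∧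
      w * (x₂ - conj x₁ * x₃) = ‖x₂ - conj x₁ * x₃‖ := by
    by_cases he : x₂ - conj x₁ * x₃ = 0
    · exact ⟨1, by simp, by simp [he]⟩
    · refine ⟨‖x₂ - conj x₁ * x₃‖ / (x₂ - conj x₁ * x₃), ?_, div_mul_cancel₀ _ he⟩
      rw [norm_div, Complex.norm_real, norm_norm, div_self (norm_ne_zero_iff.2 he)]
  have hle := norm_sub_mul_le_of_mem_closedTetra h (w := w) (by simp [hw])
  have hsq := pow_le_pow_left₀ (norm_nonneg _) hle 2
  have hre : (w * (x₂ - conj x₁ * x₃)).re = ‖x₂ - conj x₁ * x₃‖ := by rw [hwe]; simp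
  have hw2 : ‖w‖ ^ 2 = 1 := by rw [hw]; norm_num
  rw [← hre]
  simp only [Complex.sq_norm, Complex.normSq_apply, Complex.sub_re, Complex.sub_im, Complex.mul_re,
    Complex.mul_im, Complex.one_re, Complex.one_im, Complex.conj_re, Complex.conj_im]
    at hsq hw2 ⊢
  linear_combination hsq + (x₂.re ^ 2 + x₂.im ^ 2 - x₃.re ^ 2 - x₃.im ^ 2) * hw2

lemma norm_bounds_of_mem_closedTetra {x₁ x₂ x₃ : ℂ} (h : (x₁, x₂, x₃) ∈ closedTetra) :
    ‖x₃‖ ≤ 1 ∧ 2 * ‖x₁ * x₂ - x₃‖ ≤ 1 + ‖x₃‖ ^ 2 - ‖x₁‖ ^ 2 - ‖x₂‖ ^ 2 := by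
  have h₁ := norm_sub_mul_le_of_mem_closedTetra h (w := 0) (by simp)
  have h₂ := norm_sub_mul_le_of_mem_closedTetra (closedTetra_swap h) (w := 0) (by simp)
  have hA := two_mul_norm_le_of_mem_closedTetra h
  have hA' := two_mul_norm_le_of_mem_closedTetra (closedTetra_swap h)
  have htri : ‖x₁‖ * ‖x₂‖ ≤ ‖x₁ * x₂ - x₃‖ + ‖x₃‖ := by
    rw [← norm_mul]; exact norm_le_norm_sub_add _ _
  have hBD : ‖x₂ - conj x₁ * x₃‖ ^ 2 - ‖x₁ * x₂ - x₃‖ ^ 2 =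
      (‖x₂‖ ^ 2 - ‖x₃‖ ^ 2) * (1 - ‖x₁‖ ^ 2) := by
    simp only [Complex.sq_norm, Complex.normSq_apply, Complex.sub_re, Complex.sub_im,
      Complex.mul_re, Complex.mul_im, Complex.conj_re, Complex.conj_im]
    ring
  simp only [mul_zero, sub_zero, norm_one] at h₁ h₂
  have hB := norm_nonneg (x₂ - conj x₁ * x₃)
  have hB' := norm_nonneg (x₁ - conj x₂ * x₃)
  have hD := norm_nonneg (x₁ * x₂ - x₃)
  have hp := norm_nonneg x₁
  have hq := norm_nonneg x₂
  have ht := norm_nonneg x₃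
  generalize ‖x₂ - conj x₁ * x₃‖ = B at *
  generalize ‖x₁ - conj x₂ * x₃‖ = B' at *
  generalize ‖x₁ * x₂ - x₃‖ = D at *
  generalize ‖x₁‖ = p at *
  generalize ‖x₂‖ = q at *
  generalize ‖x₃‖ = t at *
  refine ⟨by nlinarith, ?_⟩
  have hCD : (2 * D) ^ 2 ≤ (1 + t ^ 2 - p ^ 2 - q ^ 2) ^ 2 := by nlinarith
  by_contra! hlt
  have hneg : 1 + t ^ 2 - p ^ 2 - q ^ 2 ≤ -(2 * D) := by
    by_contra! hgt
    nlinarith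
  have hp2 : 0 ≤ 1 - p ^ 2 := by nlinarith
  have hq2 : 0 ≤ 1 - q ^ 2 := by nlinarith
  have hpq2 := mul_nonneg hp2 hq2
  have hpq1 : p * q ≤ 1 := by nlinarith
  by_cases hpq : D ≤ p * q
  · have ht2 : (p * q - D) ^ 2 ≤ t ^ 2 := pow_le_pow_left₀ (by linarith) (by linarith) 2
    have := mul_nonneg hD (sub_nonneg.2 hpq1)
    have hD0 : D = 0 := by
      by_contra hne
      have : 0 < D ^ 2 := by positivity
      nlinarith
    subst hD0
    nlinarith
  · push Not at hpq
    nlinarith [mul_nonneg hp hq, mul_nonneg hp (sub_nonneg.2 h₁), mul_nonneg hq (sub_nonneg.2 h₂)]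

lemma two_mul_le_of_sq_le_mul {α δ β x y : ℝ} (hα : 0 ≤ α) (hδ : 0 ≤ δ)
    (h : β ^ 2 ≤ α * δ) : 2 * (β * (x * y)) ≤ α * x ^ 2 + δ * y ^ 2 := by
  have h1 := mul_le_mul_of_nonneg_right h (sq_nonneg (x * y))
  refine le_of_abs_le (abs_le_of_sq_le_sq ?_ (by positivity))
  nlinarith [sq_nonneg (α * x ^ 2 - δ * y ^ 2)]

lemma opNorm2_le_one_of_norm_eq {a b c d : ℂ} (h : (a, d, a * d - b * c) ∈ closedTetra)
    (hbc : ‖b‖ = ‖c‖) : opNorm2 !![a, b; c, d] ≤ 1 := by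
  obtain ⟨ht, hC⟩ := norm_bounds_of_mem_closedTetra h
  rw [sub_sub_cancel, norm_mul, ← hbc] at hC
  have hβ : ‖conj a * b + conj c * d‖ ^ 2 ≤
      (1 - ‖a‖ ^ 2 - ‖c‖ ^ 2) * (1 - ‖b‖ ^ 2 - ‖d‖ ^ 2) := by
    have hid : ‖conj a * b + conj c * d‖ ^ 2 = ‖a‖ ^ 2 * ‖b‖ ^ 2 + ‖c‖ ^ 2 * ‖d‖ ^ 2 +
        ‖a‖ ^ 2 * ‖d‖ ^ 2 + ‖b‖ ^ 2 * ‖c‖ ^ 2 - ‖a * d - b * c‖ ^ 2 := by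
      simp only [Complex.sq_norm, Complex.normSq_apply, Complex.sub_re, Complex.sub_im,
        Complex.add_re, Complex.add_im, Complex.mul_re, Complex.mul_im, Complex.conj_re,
        Complex.conj_im]
      ring
    rw [hid, ← hbc]
    nlinarith
  have hsum : 0 ≤ (1 - ‖a‖ ^ 2 - ‖c‖ ^ 2) + (1 - ‖b‖ ^ 2 - ‖d‖ ^ 2) := by
    rw [← hbc]
    nlinarith [norm_nonneg (a * d - b * c)]
  have hprod := (sq_nonneg _).trans hβ
  have hα : 0 ≤ 1 - ‖a‖ ^ 2 - ‖c‖ ^ 2 := by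
    by_contra! hlt
    nlinarith
  have hδ : 0 ≤ 1 - ‖b‖ ^ 2 - ‖d‖ ^ 2 := by
    by_contra! hlt
    nlinarith
  refine ContinuousLinearMap.opNorm_le_bound _ zero_le_one fun v ↦ ?_
  rw [one_mul]
  refine le_of_sq_le_sq ?_ (norm_nonneg v)
  rw [EuclideanSpace.norm_sq_eq, EuclideanSpace.norm_sq_eq]
  have h0 : (Matrix.toEuclideanCLM (𝕜 := ℂ) !![a, b; c, d] v) 0 = a * v 0 + b * v 1 := by
    simp [Matrix.mulVec, dotProduct, Fin.sum_univ_two]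
  have h1 : (Matrix.toEuclideanCLM (𝕜 := ℂ) !![a, b; c, d] v) 1 = c * v 0 + d * v 1 := by
    simp [Matrix.mulVec, dotProduct, Fin.sum_univ_two]
  rw [Fin.sum_univ_two, Fin.sum_univ_two, h0, h1]
  have hform := two_mul_le_of_sq_le_mul (x := ‖v 0‖) (y := ‖v 1‖) hα hδ hβ
  have hre : ((conj a * b + conj c * d) * (conj (v 0) * v 1)).re ≤
      ‖conj a * b + conj c * d‖ * (‖v 0‖ * ‖v 1‖) := by
    refine (Complex.re_le_norm _).trans_eq ?_
    rw [norm_mul, norm_mul, RCLike.norm_conj]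
  have hexp : ‖a * v 0 + b * v 1‖ ^ 2 + ‖c * v 0 + d * v 1‖ ^ 2 =
      (‖a‖ ^ 2 + ‖c‖ ^ 2) * ‖v 0‖ ^ 2 + (‖b‖ ^ 2 + ‖d‖ ^ 2) * ‖v 1‖ ^ 2 +
        2 * ((conj a * b + conj c * d) * (conj (v 0) * v 1)).re := by
    simp only [Complex.sq_norm, Complex.normSq_apply, Complex.add_re, Complex.add_im,
      Complex.mul_re, Complex.mul_im, Complex.conj_re, Complex.conj_im]
    ring
  linarith

lemma finite_zeros_of_differentiableOn {f : ℂ → ℂ} {U K : Set ℂ} (hU : IsOpen U)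
    (hUc : IsPreconnected U) (hf : DifferentiableOn ℂ f U) (hne : ∃ z ∈ U, f z ≠ 0)
    (hK : IsCompact K) (hKU : K ⊆ U) : {z ∈ K | f z = 0}.Finite := by
  by_contra hinf
  obtain ⟨z, hz, hacc⟩ := Set.Infinite.exists_accPt_of_subset_isCompact hinf hK fun z hz ↦ hz.1
  obtain ⟨u, hu, hfu⟩ := hne
  refine hfu ((hf.analyticOnNhd hU).eqOn_zero_of_preconnected_of_frequently_eq_zero hUc
    (hKU hz) ?_ hu)
  exact (accPt_iff_frequently_nhdsNE.1 hacc).mono fun w hw ↦ hw.2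

lemma exists_radius_forall_sphere_ne_zero {f : ℂ → ℂ} (hf : DifferentiableOn ℂ f (ball 0 1))
    (hne : ∃ z ∈ ball (0 : ℂ) 1, f z ≠ 0) {a : ℝ} (ha : a < 1) :
    ∃ r, a < r ∧ r < 1 ∧ ∀ z ∈ sphere (0 : ℂ) r, f z ≠ 0 := by
  obtain ⟨b, hab, hb⟩ := exists_between ha
  have hfin := finite_zeros_of_differentiableOn isOpen_ball
    (convex_ball (0 : ℂ) 1).isPreconnected hf hne (isCompact_closedBall (0 : ℂ) b)
    (closedBall_subset_ball hb)
  obtain ⟨r, hr, hrz⟩ := (Set.Ioo_infinite hab).exists_notMem_finite (hfin.image norm)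
  refine ⟨r, hr.1, hr.2.trans hb, fun z hz h0 ↦ hrz ⟨z, ⟨?_, h0⟩, by simpa using hz⟩⟩
  rw [mem_sphere_zero_iff_norm] at hz
  rw [mem_closedBall_zero_iff, hz]
  exact hr.2.le

lemma exists_eq_pow_mul_of_differentiableOn {f : ℂ → ℂ} {U : Set ℂ} (hU : IsOpen U)
    (hf : DifferentiableOn ℂ f U) {u : ℂ} (hu : u ∈ U) (hne : ¬ ∀ᶠ z in 𝓝 u, f z = 0) :
    ∃ (n : ℕ) (g : ℂ → ℂ), DifferentiableOn ℂ g U ∧ g u ≠ 0 ∧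
      ∀ z ∈ U, f z = (z - u) ^ n * g z := by
  classical
  obtain ⟨n, g, hg, hgu, hfg⟩ :=
    ((hf.analyticOnNhd hU) u hu).exists_eventuallyEq_pow_smul_nonzero_iff.2 hne
  let g' : ℂ → ℂ := fun z ↦ if z = u then g u else f z / (z - u) ^ n
  have hg' : g' =ᶠ[𝓝 u] g := by
    filter_upwards [hfg] with z hz
    by_cases hzu : z = u
    · simp [g', hzu]
    · have := pow_ne_zero n (sub_ne_zero.2 hzu)
      simp only [g', if_neg hzu, hz, smul_eq_mul]
      field_simp
  refine ⟨n, g', fun z hz ↦ DifferentiableAt.differentiableWithinAt ?_, by simpa [g'], fun z hz ↦ ?_⟩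
  · by_cases hzu : z = u
    · rw [hzu]
      exact hg.differentiableAt.congr_of_eventuallyEq hg'
    · have hd : DifferentiableAt ℂ (fun z ↦ f z / (z - u) ^ n) z :=
        ((hf.differentiableAt (hU.mem_nhds hz))).div (by fun_prop)
          (pow_ne_zero n (sub_ne_zero.2 hzu))
      refine hd.congr_of_eventuallyEq ?_
      filter_upwards [isOpen_ne.mem_nhds hzu] with w hw
      exact if_neg hw
  · by_cases hzu : z = u
    · subst hzu
      simpa [g'] using hfg.self_of_nhds
    · have := pow_ne_zero n (sub_ne_zero.2 hzu)
      simp only [g', if_neg hzu]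
      field_simp

lemma sq_sub_conj_mul_ne_zero {r : ℝ} {u z : ℂ} (hu : u ∈ ball (0 : ℂ) r)
    (hz : z ∈ closedBall (0 : ℂ) r) : (r : ℂ) ^ 2 - conj u * z ≠ 0 := by
  rw [mem_ball_zero_iff] at hu
  rw [mem_closedBall_zero_iff] at hz
  intro h0
  have := congrArg norm (sub_eq_zero.1 h0)
  rw [norm_pow, Complex.norm_real, norm_mul, RCLike.norm_conj, Real.norm_eq_abs, sq_abs] at this
  nlinarith [norm_nonneg u, norm_nonneg z]

lemma norm_mul_sub_eq_norm_sq_sub_conj_mul {r : ℝ} (hr : 0 ≤ r) {u z : ℂ}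
    (hz : z ∈ sphere (0 : ℂ) r) :
    ‖(r : ℂ) * (z - u)‖ = ‖(r : ℂ) ^ 2 - conj u * z‖ := by
  rw [mem_sphere_zero_iff_norm] at hz
  have h : (r : ℂ) ^ 2 - conj u * z = z * conj (z - u) := by
    rw [map_sub, mul_sub, Complex.mul_conj', hz]
    ring
  rw [h, norm_mul, norm_mul, RCLike.norm_conj, hz, Complex.norm_real, Real.norm_of_nonneg hr]

lemma exists_blaschke_factorization {r : ℝ} (hr0 : 0 < r) (hr1 : r < 1) (S : Finset ℂ) :
    (∀ u ∈ S, u ∈ ball (0 : ℂ) r) → ∀ f : ℂ → ℂ, DifferentiableOn ℂ f (ball 0 1) →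
    (∀ z ∈ closedBall (0 : ℂ) r, f z = 0 → z ∈ S) →
    ∃ P Q g : ℂ → ℂ, Differentiable ℂ P ∧ Differentiable ℂ Q ∧
      DifferentiableOn ℂ g (ball 0 1) ∧ (∀ z ∈ ball (0 : ℂ) 1, f z = P z * g z) ∧
      (∀ z ∈ closedBall (0 : ℂ) r, g z ≠ 0) ∧ (∀ z ∈ closedBall (0 : ℂ) r, Q z ≠ 0) ∧
      ∀ z ∈ sphere (0 : ℂ) r, ‖P z‖ = ‖Q z‖ := by
  classical
  induction S using Finset.induction_on with
  | empty =>
    intro _ f hf hz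
    exact ⟨fun _ ↦ 1, fun _ ↦ 1, f, by fun_prop, by fun_prop, hf, by simp,
      fun z hzr h0 ↦ by simpa using hz z hzr h0, by simp, by simp⟩
  | insert u S _ ih =>
    intro hS f hf hz
    have hu : u ∈ ball (0 : ℂ) r := hS u (Finset.mem_insert_self u S)
    have hu1 : u ∈ ball (0 : ℂ) 1 := ball_subset_ball hr1.le hu
    have hne : ¬ ∀ᶠ z in 𝓝 u, f z = 0 := by
      intro h0
      refine infinite_of_mem_nhds u (inter_mem h0 (isOpen_ball.mem_nhds hu))
        ((insert u S).finite_toSet.subset fun z hz' ↦ ?_)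
      exact hz z (ball_subset_closedBall hz'.2) hz'.1
    obtain ⟨n, g₁, hg₁, hg₁u, hfg₁⟩ := exists_eq_pow_mul_of_differentiableOn isOpen_ball hf hu1 hne
    obtain ⟨P, Q, g, hP, hQ, hg, hPg, hg0, hQ0, hPQ⟩ := ih
      (fun v hv ↦ hS v (Finset.mem_insert_of_mem hv)) g₁ hg₁ fun z hzr h0 ↦ by
        have hzS := hz z hzr (by rw [hfg₁ z (closedBall_subset_ball hr1 hzr), h0, mul_zero])
        refine (Finset.mem_insert.1 hzS).resolve_left ?_
        rintro rfl
        exact hg₁u h0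
    have hrC : (r : ℂ) ≠ 0 := by exact_mod_cast hr0.ne'
    refine ⟨fun z ↦ (r * (z - u)) ^ n * P z, fun z ↦ (r ^ 2 - conj u * z) ^ n * Q z,
      fun z ↦ ((r : ℂ) ^ n)⁻¹ * g z, by fun_prop, by fun_prop, hg.const_mul _, fun z hz ↦ ?_,
      fun z hz ↦ mul_ne_zero (inv_ne_zero (pow_ne_zero n hrC)) (hg0 z hz),
      fun z hz ↦ mul_ne_zero (pow_ne_zero n (sq_sub_conj_mul_ne_zero hu hz)) (hQ0 z hz),
      fun z hz ↦ ?_⟩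
    · have := pow_ne_zero n hrC
      simp only [hfg₁ z hz, hPg z hz, mul_pow]
      field_simp
    · simp only [norm_mul, norm_pow, hPQ z hz]
      rw [← norm_mul, norm_mul_sub_eq_norm_sq_sub_conj_mul hr0.le hz]

lemma exists_sq_eq_of_forall_ne_zero {G : ℂ → ℂ} {R : ℝ} (hR : 0 < R)
    (hG : DifferentiableOn ℂ G (ball 0 R)) (hG0 : ∀ z ∈ ball (0 : ℂ) R, G z ≠ 0) :
    ∃ s : ℂ → ℂ, DifferentiableOn ℂ s (ball 0 R) ∧ ∀ z ∈ ball (0 : ℂ) R, s z ^ 2 = G z := by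
  obtain ⟨φ, hφ⟩ : Complex.IsExactOn (fun z ↦ deriv G z / G z) (ball 0 R) :=
    ((hG.deriv isOpen_ball).div hG hG0).isExactOn_ball
  have hderiv : ∀ z ∈ ball (0 : ℂ) R, HasDerivAt (fun z ↦ G z * Complex.exp (-φ z)) 0 z := by
    intro z hz
    have h1 := (hG.differentiableAt (isOpen_ball.mem_nhds hz)).hasDerivAt
    have := h1.mul (hφ z hz).neg.cexp
    refine this.congr_deriv ?_
    have := hG0 z hz
    field_simp
    ring
  have h0 : (0 : ℂ) ∈ ball (0 : ℂ) R := mem_ball_self hR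
  have hconst : ∀ z ∈ ball (0 : ℂ) R,
      G z * Complex.exp (-φ z) = G 0 * Complex.exp (-φ 0) := fun z hz ↦
    isOpen_ball.is_const_of_deriv_eq_zero (convex_ball (0 : ℂ) R).isPreconnected
      (fun w hw ↦ (hderiv w hw).differentiableAt.differentiableWithinAt)
      (fun w hw ↦ (hderiv w hw).deriv) hz h0
  obtain ⟨c, hc⟩ := IsAlgClosed.exists_pow_nat_eq (G 0 * Complex.exp (-φ 0)) two_pos
  refine ⟨fun z ↦ c * Complex.exp (φ z / 2), fun z hz ↦ ?_, fun z hz ↦ ?_⟩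
  · exact (((hφ z hz).differentiableAt.div_const 2).cexp.const_mul c).differentiableWithinAt
  · rw [mul_pow, hc, ← hconst z hz, ← Complex.exp_nat_mul, mul_assoc, ← Complex.exp_add]
    push_cast
    rw [mul_div_cancel₀ _ two_ne_zero, neg_add_cancel, Complex.exp_zero, mul_one]

lemma exists_mul_eq_norm_eq_on_sphere {h : ℂ → ℂ} (hh : DifferentiableOn ℂ h (ball 0 1)) {r : ℝ}
    (hr0 : 0 < r) (hr1 : r < 1) (hne : ∀ z ∈ sphere (0 : ℂ) r, h z ≠ 0) :
    ∃ b c : ℂ → ℂ, ∃ R, r < R ∧ DifferentiableOn ℂ b (ball 0 R) ∧ DifferentiableOn ℂ c (ball 0 R) ∧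
      (∀ z ∈ ball (0 : ℂ) R, b z * c z = h z) ∧ ∀ z ∈ sphere (0 : ℂ) r, ‖b z‖ = ‖c z‖ := by
  have hrs : (r : ℂ) ∈ sphere (0 : ℂ) r := by simp [hr0.le]
  have hfin := finite_zeros_of_differentiableOn isOpen_ball
    (convex_ball (0 : ℂ) 1).isPreconnected hh
    ⟨r, closedBall_subset_ball hr1 (sphere_subset_closedBall hrs), hne _ hrs⟩
    (isCompact_closedBall (0 : ℂ) r) (closedBall_subset_ball hr1)
  obtain ⟨P, Q, g, hP, hQ, hg, hPg, hg0, hQ0, hPQ⟩ :=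
    exists_blaschke_factorization hr0 hr1 hfin.toFinset (fun u hu ↦ by
      rw [Set.Finite.mem_toFinset] at hu
      refine mem_ball.2 (lt_of_le_of_ne (mem_closedBall.1 hu.1) fun he ↦ ?_)
      exact hne u (mem_sphere.2 he) hu.2) h hh
      fun z hz h0 ↦ by rw [Set.Finite.mem_toFinset]; exact ⟨hz, h0⟩
  have hVo : IsOpen (ball (0 : ℂ) 1 ∩ (fun z ↦ g z * Q z) ⁻¹' {0}ᶜ) :=
    (hg.mul hQ.differentiableOn).continuousOn.isOpen_inter_preimage isOpen_ball
      isOpen_compl_singleton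
  obtain ⟨δ, hδ, hδV⟩ := (isCompact_closedBall (0 : ℂ) r).exists_thickening_subset_open hVo
    fun z hz ↦ ⟨closedBall_subset_ball hr1 hz, mul_ne_zero (hg0 z hz) (hQ0 z hz)⟩
  rw [thickening_closedBall hδ hr0.le] at hδV
  have hG : DifferentiableOn ℂ (fun z ↦ g z * Q z) (ball 0 (δ + r)) :=
    (hg.mul hQ.differentiableOn).mono fun z hz ↦ (hδV hz).1
  obtain ⟨s, hs, hs2⟩ := exists_sq_eq_of_forall_ne_zero (by positivity) hG fun z hz ↦ (hδV hz).2
  have hQ0' : ∀ z ∈ ball (0 : ℂ) (δ + r), Q z ≠ 0 := fun z hz ↦ right_ne_zero_of_mul (hδV hz).2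
  refine ⟨fun z ↦ P z / Q z * s z, s, δ + r, by linarith,
    (hP.differentiableOn.div hQ.differentiableOn hQ0').mul hs, hs, fun z hz ↦ ?_, fun z hz ↦ ?_⟩
  · have := hQ0' z hz
    rw [hPg z (hδV hz).1, mul_assoc, ← sq, hs2 z hz]
    field_simp
  · have hQz := norm_ne_zero_iff.2 (hQ0 z (sphere_subset_closedBall hz))
    rw [norm_mul, norm_div, hPQ z hz, div_self hQz, one_mul]

lemma exists_norm_sub_sub_mul_le {f : ℂ → ℂ} {c : ℂ} {R : ℝ} (hR : 0 < R)
    (hf : DifferentiableOn ℂ f (ball c R)) (hf1 : ∀ z ∈ ball c R, ‖f z‖ ≤ 1) :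
    ‖deriv f c‖ ≤ 2 / R ∧ ∀ z ∈ ball c R,
      ‖f z - f c - (z - c) * deriv f c‖ ≤ 4 / R / R * ‖z - c‖ ^ 2 := by
  have hc : c ∈ ball c R := mem_ball_self hR
  have hnhds : ball c R ∈ 𝓝 c := isOpen_ball.mem_nhds hc
  have h1 : ∀ z ∈ ball c R, ‖dslope f c z‖ ≤ 2 / R := fun z hz ↦ by
    refine Complex.norm_dslope_le_div_of_mapsTo_ball hf (fun w hw ↦ ?_) hz
    rw [mem_closedBall_iff_norm]
    linarith [norm_sub_le (f w) (f c), hf1 w hw, hf1 c hc]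
  have hd : DifferentiableOn ℂ (dslope f c) (ball c R) :=
    (Complex.differentiableOn_dslope hnhds).2 hf
  have h2 : ∀ z ∈ ball c R, ‖dslope (dslope f c) c z‖ ≤ 4 / R / R := fun z hz ↦ by
    refine Complex.norm_dslope_le_div_of_mapsTo_ball hd (fun w hw ↦ ?_) hz
    rw [mem_closedBall_iff_norm]
    have := norm_sub_le (dslope f c w) (dslope f c c)
    have h4 : 4 / R = 2 / R + 2 / R := by ring
    linarith [h1 w hw, h1 c hc]
  refine ⟨by simpa using h1 c hc, fun z hz ↦ ?_⟩
  have e1 := sub_smul_dslope f c z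
  have e2 := sub_smul_dslope (dslope f c) c z
  rw [dslope_same, smul_eq_mul] at e2
  rw [smul_eq_mul] at e1
  have : f z - f c - (z - c) * deriv f c = (z - c) ^ 2 * dslope (dslope f c) c z := by
    rw [← e1, sq, mul_assoc, e2, mul_sub]
  rw [this, norm_mul, norm_pow, mul_comm]
  gcongr
  exact h2 z hz

lemma Ultrafilter.exists_tendsto_of_eventually_norm_le {ι : Type*} (l : Ultrafilter ι)
    {f : ι → ℂ} {C : ℝ} (hf : ∀ᶠ n in l, ‖f n‖ ≤ C) : ∃ a, Tendsto f l (𝓝 a) := by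
  obtain ⟨a, -, ha⟩ := (isCompact_closedBall (0 : ℂ) C).ultrafilter_le_nhds (l.map f)
    (le_principal_iff.2 <| hf.mono fun n hn ↦ mem_closedBall_zero_iff.2 hn)
  exact ⟨a, ha⟩

lemma Ultrafilter.exists_differentiableOn_tendsto {ι : Type*} (l : Ultrafilter ι)
    {F : ι → ℂ → ℂ} {U : Set ℂ}
    (hF : ∀ z ∈ U, ∃ R > 0, ∀ᶠ n in l, DifferentiableOn ℂ (F n) (ball z R) ∧
      ∀ w ∈ ball z R, ‖F n w‖ ≤ 1) :
    ∃ f : ℂ → ℂ, DifferentiableOn ℂ f U ∧ ∀ z ∈ U, Tendsto (F · z) l (𝓝 (f z)) := by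
  have hlim : ∀ z, ∃ a, (∃ C : ℝ, ∀ᶠ n in l, ‖F n z‖ ≤ C) → Tendsto (F · z) l (𝓝 a) := by
    intro z
    by_cases hz : ∃ C : ℝ, ∀ᶠ n in l, ‖F n z‖ ≤ C
    · obtain ⟨a, ha⟩ := l.exists_tendsto_of_eventually_norm_le hz.choose_spec
      exact ⟨a, fun _ ↦ ha⟩
    · exact ⟨0, fun h ↦ absurd h hz⟩
  choose f hf using hlim
  refine ⟨f, fun z hz ↦ ?_, fun z hz ↦ ?_⟩
  · obtain ⟨R, hR, hFR⟩ := hF z hz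
    have hlimw : ∀ w ∈ ball z R, Tendsto (F · w) l (𝓝 (f w)) := fun w hw ↦
      hf w ⟨1, hFR.mono fun n hn ↦ hn.2 w hw⟩
    have hest := hFR.mono fun n hn ↦ exists_norm_sub_sub_mul_le hR hn.1 hn.2
    obtain ⟨L, hL⟩ := l.exists_tendsto_of_eventually_norm_le (hest.mono fun n hn ↦ hn.1)
    have hbound : ∀ w ∈ ball z R, ‖f w - f z - (w - z) * L‖ ≤ 4 / R / R * ‖w - z‖ ^ 2 :=
      fun w hw ↦ le_of_tendsto
        (((hlimw w hw).sub (hlimw z (mem_ball_self hR))).sub (hL.const_mul (w - z))).norm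
        (hest.mono fun n hn ↦ hn.2 w hw)
    have hderiv : HasDerivAt f L z := by
      rw [hasDerivAt_iff_isLittleO]
      refine Asymptotics.IsBigO.trans_isLittleO
        (g := fun w ↦ ‖w - z‖ ^ 2) (Asymptotics.IsBigO.of_bound (4 / R / R) ?_) ?_
      · filter_upwards [isOpen_ball.mem_nhds (mem_ball_self hR)] with w hw
        simpa using hbound w hw
      · exact Asymptotics.isLittleO_pow_sub_sub z one_lt_two
    exact hderiv.differentiableAt.differentiableWithinAt
  · obtain ⟨R, hR, hFR⟩ := hF z hz
    exact hf z ⟨1, hFR.mono fun n hn ↦ hn.2 z (mem_ball_self hR)⟩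

lemma toEuclideanCLM_eq_sum (A : Matrix (Fin 2) (Fin 2) ℂ) :
    Matrix.toEuclideanCLM (𝕜 := ℂ) A =
      ∑ i, ∑ j, A i j • Matrix.toEuclideanCLM (𝕜 := ℂ) (Matrix.single i j 1) := by
  conv_lhs => rw [Matrix.matrix_eq_sum_single A]
  simp only [map_sum, ← map_smul, Matrix.smul_single, smul_eq_mul, mul_one]

lemma differentiableOn_toEuclideanCLM {F : ℂ → Matrix (Fin 2) (Fin 2) ℂ} {U : Set ℂ}
    (hF : ∀ i j, DifferentiableOn ℂ (fun z ↦ F z i j) U) :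
    DifferentiableOn ℂ (fun z ↦ Matrix.toEuclideanCLM (𝕜 := ℂ) (F z)) U := by
  simp_rw [toEuclideanCLM_eq_sum (F _)]
  exact DifferentiableOn.fun_sum fun i _ ↦ DifferentiableOn.fun_sum fun j _ ↦
    (hF i j).smul_const _

lemma tendsto_opNorm2 {ι : Type*} {l : Filter ι} {F : ι → Matrix (Fin 2) (Fin 2) ℂ}
    {A : Matrix (Fin 2) (Fin 2) ℂ} (hF : ∀ i j, Tendsto (fun n ↦ F n i j) l (𝓝 (A i j))) :
    Tendsto (fun n ↦ opNorm2 (F n)) l (𝓝 (opNorm2 A)) := by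
  unfold opNorm2
  simp_rw [toEuclideanCLM_eq_sum (F _)]
  rw [toEuclideanCLM_eq_sum A]
  exact (tendsto_finsetSum _ fun i _ ↦ tendsto_finsetSum _ fun j _ ↦
    (hF i j).smul_const _).norm

lemma norm_apply_le_opNorm2 (A : Matrix (Fin 2) (Fin 2) ℂ) (i j : Fin 2) :
    ‖A i j‖ ≤ opNorm2 A := by
  have h := (Matrix.toEuclideanCLM (𝕜 := ℂ) A).le_opNorm (EuclideanSpace.single j 1)
  rw [PiLp.norm_single, norm_one, mul_one] at h
  refine le_trans ?_ ((PiLp.norm_apply_le _ i).trans h)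
  simp

lemma opNorm2_le_one_of_forall_sphere {F : ℂ → Matrix (Fin 2) (Fin 2) ℂ} {r R : ℝ} (hr0 : 0 < r)
    (hrR : r < R) (hF : ∀ i j, DifferentiableOn ℂ (fun z ↦ F z i j) (ball 0 R))
    (hF1 : ∀ z ∈ sphere (0 : ℂ) r, opNorm2 (F z) ≤ 1) {z : ℂ} (hz : z ∈ ball (0 : ℂ) r) :
    opNorm2 (F z) ≤ 1 := by
  have hd := differentiableOn_toEuclideanCLM hF
  refine Complex.norm_le_of_forall_mem_frontier_norm_le
    (f := fun z ↦ Matrix.toEuclideanCLM (𝕜 := ℂ) (F z)) (U := ball 0 r) isBounded_ball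
    ⟨hd.mono (ball_subset_ball hrR.le), ?_⟩ (fun w hw ↦ ?_) (subset_closure hz)
  · rw [closure_ball _ hr0.ne']
    exact hd.continuousOn.mono (closedBall_subset_ball hrR)
  · rw [frontier_ball _ hr0.ne'] at hw
    exact hF1 w hw

lemma exists_offDiag_of_forall_sphere_ne_zero {x₁ x₂ x₃ : ℂ → ℂ}
    (h₁ : DifferentiableOn ℂ x₁ (ball 0 1)) (h₂ : DifferentiableOn ℂ x₂ (ball 0 1))
    (h₃ : DifferentiableOn ℂ x₃ (ball 0 1))
    (hxE : ∀ z ∈ ball (0 : ℂ) 1, (x₁ z, x₂ z, x₃ z) ∈ closedTetra) {r : ℝ} (hr0 : 0 < r)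
    (hr1 : r < 1) (hne : ∀ z ∈ sphere (0 : ℂ) r, x₁ z * x₂ z - x₃ z ≠ 0) :
    ∃ b c : ℂ → ℂ, DifferentiableOn ℂ b (ball 0 r) ∧ DifferentiableOn ℂ c (ball 0 r) ∧
      (∀ z ∈ ball (0 : ℂ) r, b z * c z = x₁ z * x₂ z - x₃ z) ∧
      ∀ z ∈ ball (0 : ℂ) r, opNorm2 !![x₁ z, b z; c z, x₂ z] ≤ 1 := by
  obtain ⟨b, c, R, hrR, hb, hc, hbc, hnorm⟩ :=
    exists_mul_eq_norm_eq_on_sphere ((h₁.mul h₂).sub h₃) hr0 hr1 hne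
  have hmin : r < min R 1 := lt_min hrR hr1
  have hR : ball (0 : ℂ) (min R 1) ⊆ ball 0 R := ball_subset_ball (min_le_left _ _)
  have h1 : ball (0 : ℂ) (min R 1) ⊆ ball 0 1 := ball_subset_ball (min_le_right _ _)
  have hrR' : ball (0 : ℂ) r ⊆ ball 0 R := ball_subset_ball hrR.le
  refine ⟨b, c, hb.mono hrR', hc.mono hrR', fun z hz ↦ hbc z (hrR' hz), fun z hz ↦
    opNorm2_le_one_of_forall_sphere (F := fun z ↦ !![x₁ z, b z; c z, x₂ z]) hr0 hmin
      (fun i j ↦ ?_) (fun w hw ↦ opNorm2_le_one_of_norm_eq ?_ (hnorm w hw)) hz⟩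
  · fin_cases i <;> fin_cases j
    exacts [h₁.mono h1, hb.mono hR, hc.mono hR, h₂.mono h1]
  · have hw' : w ∈ closedBall (0 : ℂ) r := sphere_subset_closedBall hw
    have he : x₁ w * x₂ w - b w * c w = x₃ w := by
      rw [hbc w (closedBall_subset_ball hrR hw')]
      simp
    rw [he]
    exact hxE w (closedBall_subset_ball hr1 hw')

lemma exists_offDiag {x₁ x₂ x₃ : ℂ → ℂ}
    (h₁ : DifferentiableOn ℂ x₁ (ball 0 1)) (h₂ : DifferentiableOn ℂ x₂ (ball 0 1))
    (h₃ : DifferentiableOn ℂ x₃ (ball 0 1))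
    (hxE : ∀ z ∈ ball (0 : ℂ) 1, (x₁ z, x₂ z, x₃ z) ∈ closedTetra) :
    ∃ b c : ℂ → ℂ, DifferentiableOn ℂ b (ball 0 1) ∧ DifferentiableOn ℂ c (ball 0 1) ∧
      (∀ z ∈ ball (0 : ℂ) 1, b z * c z = x₁ z * x₂ z - x₃ z) ∧
      ∀ z ∈ ball (0 : ℂ) 1, opNorm2 !![x₁ z, b z; c z, x₂ z] ≤ 1 := by
  by_cases h0 : ∃ z ∈ ball (0 : ℂ) 1, x₁ z * x₂ z - x₃ z ≠ 0
  · have hrad : ∀ n : ℕ, ∃ r : ℝ, 1 - 1 / (n + 1 : ℝ) < r ∧ r < 1 ∧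
        ∀ z ∈ sphere (0 : ℂ) r, x₁ z * x₂ z - x₃ z ≠ 0 := fun n ↦
      exists_radius_forall_sphere_ne_zero ((h₁.mul h₂).sub h₃) h0
        (sub_lt_self 1 Nat.one_div_pos_of_nat)
    choose r hr hr1 hrne using hrad
    have hr0 : ∀ n, 0 < r n := fun n ↦ lt_of_le_of_lt
      (sub_nonneg.2 ((div_le_one n.cast_add_one_pos).2 (by simp))) (hr n)
    choose b c hb hc hbc hnorm using fun n ↦
      exists_offDiag_of_forall_sphere_ne_zero h₁ h₂ h₃ hxE (hr0 n) (hr1 n) (hrne n)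
    let l : Ultrafilter ℕ := Ultrafilter.of atTop
    have hlim : Tendsto r l (𝓝 1) := by
      refine Tendsto.mono_left ?_ (Ultrafilter.of_le atTop)
      refine tendsto_of_tendsto_of_tendsto_of_le_of_le ?_ tendsto_const_nhds
        (fun n ↦ (hr n).le) fun n ↦ (hr1 n).le
      simpa using (tendsto_one_div_add_atTop_nhds_zero_nat (𝕜 := ℝ)).const_sub 1
    have hsub : ∀ z ∈ ball (0 : ℂ) 1, ∃ ρ > 0, ∀ᶠ n in l, ball z ρ ⊆ ball 0 (r n) := by
      intro z hz
      rw [mem_ball_zero_iff] at hz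
      refine ⟨(1 - ‖z‖) / 2, by linarith, ?_⟩
      filter_upwards [hlim.eventually_const_lt (show (1 + ‖z‖) / 2 < 1 by linarith)] with n hn
      refine ball_subset_ball' ?_
      rw [dist_zero_right]
      linarith
    have hmem : ∀ z ∈ ball (0 : ℂ) 1, ∀ᶠ n in l, z ∈ ball (0 : ℂ) (r n) := fun z hz ↦ by
      obtain ⟨ρ, hρ, h⟩ := hsub z hz
      exact h.mono fun n hn ↦ hn (mem_ball_self hρ)
    obtain ⟨b', hb', hbl⟩ := l.exists_differentiableOn_tendsto (F := b) (U := ball 0 1) fun z hz ↦ by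
      obtain ⟨ρ, hρ, h⟩ := hsub z hz
      exact ⟨ρ, hρ, h.mono fun n hn ↦ ⟨(hb n).mono hn, fun w hw ↦
        (norm_apply_le_opNorm2 !![x₁ w, b n w; c n w, x₂ w] 0 1).trans (hnorm n w (hn hw))⟩⟩
    obtain ⟨c', hc', hcl⟩ := l.exists_differentiableOn_tendsto (F := c) (U := ball 0 1) fun z hz ↦ by
      obtain ⟨ρ, hρ, h⟩ := hsub z hz
      exact ⟨ρ, hρ, h.mono fun n hn ↦ ⟨(hc n).mono hn, fun w hw ↦
        (norm_apply_le_opNorm2 !![x₁ w, b n w; c n w, x₂ w] 1 0).trans (hnorm n w (hn hw))⟩⟩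
    refine ⟨b', c', hb', hc', fun z hz ↦ ?_, fun z hz ↦ ?_⟩
    · refine tendsto_nhds_unique ((hbl z hz).mul (hcl z hz)) (tendsto_const_nhds.congr' ?_)
      exact (hmem z hz).mono fun n hn ↦ (hbc n z hn).symm
    · refine le_of_tendsto (tendsto_opNorm2 (F := fun n ↦ !![x₁ z, b n z; c n z, x₂ z])
        (l := l) fun i j ↦ ?_) ((hmem z hz).mono fun n hn ↦ hnorm n z hn)
      fin_cases i <;> fin_cases j
      exacts [tendsto_const_nhds, hbl z hz, hcl z hz, tendsto_const_nhds]
  · push Not at h0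
    refine ⟨fun _ ↦ 0, fun _ ↦ 0, by fun_prop, by fun_prop, fun z hz ↦ by simp [h0 z hz],
      fun z hz ↦ opNorm2_le_one_of_norm_eq ?_ rfl⟩
    have := hxE z hz
    rwa [← sub_eq_zero.1 (h0 z hz), ← sub_zero (x₁ z * x₂ z), ← mul_zero (0 : ℂ)] at this

lemma one_sub_conj_Psi_mul_Psi (A B : Matrix (Fin 2) (Fin 2) ℂ) {w z : ℂ}
    (hw : 1 - A 1 1 * w ≠ 0) (hz : 1 - B 1 1 * z ≠ 0) :
    1 - conj (Psi w (A 0 0) (A 1 1) A.det) * Psi z (B 0 0) (B 1 1) B.det =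
      (1 - conj w * z) * conj ((1 - A 1 1 * w)⁻¹ * A 1 0) * ((1 - B 1 1 * z)⁻¹ * B 1 0) +
        star ![1, w * ((1 - A 1 1 * w)⁻¹ * A 1 0)] ⬝ᵥ
          ((1 - Aᴴ * B) *ᵥ ![1, z * ((1 - B 1 1 * z)⁻¹ * B 1 0)]) := by
  have hw' : conj (1 - A 1 1 * w) ≠ 0 := (map_ne_zero _).2 hw
  have hPsi : ∀ (C : Matrix (Fin 2) (Fin 2) ℂ) {v : ℂ}, 1 - C 1 1 * v ≠ 0 →
      Psi v (C 0 0) (C 1 1) C.det = C 0 0 + C 0 1 * (v * ((1 - C 1 1 * v)⁻¹ * C 1 0)) := by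
    intro C v hv
    have hv' : C 1 1 * v - 1 ≠ 0 := by rwa [← neg_sub, neg_ne_zero]
    rw [Psi, Matrix.det_fin_two, div_eq_iff hv']
    field_simp
    ring
  have hγ : ∀ (C : Matrix (Fin 2) (Fin 2) ℂ) {v : ℂ}, 1 - C 1 1 * v ≠ 0 →
      (1 - C 1 1 * v)⁻¹ * C 1 0 = C 1 0 + C 1 1 * (v * ((1 - C 1 1 * v)⁻¹ * C 1 0)) := by
    intro C v hv
    field_simp
    ring
  rw [hPsi A hw, hPsi B hz]
  have hγA := congrArg conj (hγ A hw)
  have hγB := hγ B hz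
  generalize (1 - A 1 1 * w)⁻¹ * A 1 0 = g at *
  generalize (1 - B 1 1 * z)⁻¹ * B 1 0 = k at *
  simp only [Matrix.mulVec, dotProduct, Fin.sum_univ_two, Matrix.sub_apply, Matrix.mul_apply,
    Matrix.conjTranspose_apply, Matrix.one_apply, Pi.star_apply, Matrix.cons_val_zero,
    Matrix.cons_val_one, map_add, map_mul, RCLike.star_def] at hγA ⊢
  simp
  linear_combination (-conj g) * hγB - (B 1 0 + B 1 1 * (z * k)) * hγA

theorem stmt_14 (x₁ x₂ x₃ : ℂ → ℂ)
    (hx : DifferentiableOn ℂ (fun z => ((x₁ z, x₂ z, x₃ z) : ℂ × ℂ × ℂ)) (Metric.ball (0:ℂ) 1))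
    (hxE : ∀ z ∈ Metric.ball (0:ℂ) 1, (x₁ z, x₂ z, x₃ z) ∈ closedTetra) :
    ∃ F : ℂ → Matrix (Fin 2) (Fin 2) ℂ,
      (∀ i j, DifferentiableOn ℂ (fun z => F z i j) (Metric.ball (0:ℂ) 1)) ∧
      (∀ z ∈ Metric.ball (0:ℂ) 1, opNorm2 (F z) ≤ 1) ∧
      (∀ z ∈ Metric.ball (0:ℂ) 1,
        x₁ z = F z 0 0 ∧ x₂ z = F z 1 1 ∧ x₃ z = (F z).det) ∧
      (∀ μ ∈ Metric.ball (0:ℂ) 1, ∀ l ∈ Metric.ball (0:ℂ) 1, ∀ w z : ℂ,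
        1 - F μ 1 1 * w ≠ 0 → 1 - F l 1 1 * z ≠ 0 →
        (let γ : ℂ → ℂ → ℂ := fun ν ζ => (1 - F ν 1 1 * ζ)⁻¹ * F ν 1 0
         let η : ℂ → ℂ → (Fin 2 → ℂ) := fun ν ζ => ![1, ζ * γ ν ζ]
         1 - (starRingEnd ℂ) (Psi w (x₁ μ) (x₂ μ) (x₃ μ)) * Psi z (x₁ l) (x₂ l) (x₃ l) =
           (1 - (starRingEnd ℂ) w * z) * (starRingEnd ℂ) (γ μ w) * γ l z +
             star (η μ w) ⬝ᵥ ((1 - (F μ)ᴴ * F l) *ᵥ η l z))) := by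
  obtain ⟨b, c, hb, hc, hbc, hnorm⟩ := exists_offDiag hx.fst hx.snd.fst hx.snd.snd hxE
  have hdet : ∀ z ∈ Metric.ball (0 : ℂ) 1, x₃ z = (!![x₁ z, b z; c z, x₂ z]).det := by
    intro z hz
    rw [Matrix.det_fin_two_of, hbc z hz, sub_sub_cancel]
  refine ⟨fun z ↦ !![x₁ z, b z; c z, x₂ z], fun i j ↦ ?_, hnorm,
    fun z hz ↦ ⟨rfl, rfl, hdet z hz⟩, fun μ hμ l hl w z hw hz ↦ ?_⟩
  · fin_cases i <;> fin_cases j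
    exacts [hx.fst, hb, hc, hx.snd.fst]
  · have := one_sub_conj_Psi_mul_Psi !![x₁ μ, b μ; c μ, x₂ μ] !![x₁ l, b l; c l, x₂ l] hw hz
    rw [← hdet μ hμ, ← hdet l hl] at this
    exact this
end
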